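/- In the Gaussian linear model with Zellner prior, for models γ̃ ⊆ γ* with γ̃ ⊄ γ, the noncentrality parameter satisfies μ(Γ(γ,γ̃), γ) ≥ n φ^{-1} ρ(X) Σ_{b=1}^B |γ̃_b ∖ γ_b| · min_{i ∈ γ̃_b ∖ γ_b} (θ*_i)², where Γ(γ,γ̃) = γ ∪ γ̃ and γ_b (resp. γ̃_b) denotes the indices of γ (resp. γ̃) in block b. -/

import Mathlib

open MeasureTheory ProbabilityTheory Matrix Filter Topology Asymptotics

noncomputable section

namespace Paper

variable {n B : ℕ} {ι : Type*} [DecidableEq ι]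

/-- Submatrix `X_γ` of the columns of `X` selected by the model `γ`. -/
def subcols (X : Fin n → ι → ℝ) (γ : Finset ι) : Matrix (Fin n) {j // j ∈ γ} ℝ :=
  fun i j => X i j.1

/-- Gram matrix `X_γᵀ X_γ`. -/
def gram (X : Fin n → ι → ℝ) (γ : Finset ι) : Matrix {j // j ∈ γ} {j // j ∈ γ} ℝ :=
  (subcols X γ)ᵀ * subcols X γ

/-- Least squares estimate `θ̂_γ = (X_γᵀX_γ)⁻¹ X_γᵀ y`. -/
def lse (X : Fin n → ι → ℝ) (γ : Finset ι) (y : Fin n → ℝ) : {j // j ∈ γ} → ℝ :=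
  (gram X γ)⁻¹ *ᵥ ((subcols X γ)ᵀ *ᵥ y)

/-- The fit statistic `θ̂_γᵀ X_γᵀ X_γ θ̂_γ`. -/
def fitStat (X : Fin n → ι → ℝ) (γ : Finset ι) (y : Fin n → ℝ) : ℝ :=
  lse X γ y ⬝ᵥ (gram X γ *ᵥ lse X γ y)

/-- Projection matrix `P_γ = X_γ (X_γᵀX_γ)⁻¹ X_γᵀ`. -/
def projMat (X : Fin n → ι → ℝ) (γ : Finset ι) : Matrix (Fin n) (Fin n) ℝ :=
  subcols X γ * (gram X γ)⁻¹ * (subcols X γ)ᵀ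

/-- Number of covariates of `γ` lying in block `b`. -/
def blockCount (z : ι → Fin B) (γ : Finset ι) (b : Fin B) : ℕ :=
  (γ.filter fun j => z j = b).card

/-- Unnormalized posterior weight of model `γ` (proportional to `p(y|γ) π(γ|ω)`). -/
def postWeight (X : Fin n → ι → ℝ) (z : ι → Fin B) (φ g : ℝ) (ω : Fin B → ℝ)
    (y : Fin n → ℝ) (γ : Finset ι) : ℝ :=
  Real.exp (g * n * fitStat X γ y / (2 * φ * (1 + g * n))) *
    ∏ b : Fin B, (ω b / (Real.sqrt (1 + g * n) * (1 - ω b))) ^ blockCount z γ b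

/-- Posterior probability `π(γ | y, ω)` among the considered models. -/
def post (X : Fin n → ι → ℝ) (z : ι → Fin B) (models : Finset (Finset ι))
    (φ g : ℝ) (ω : Fin B → ℝ) (y : Fin n → ℝ) (γ : Finset ι) : ℝ :=
  postWeight X z φ g ω y γ / ∑ γ' ∈ models, postWeight X z φ g ω y γ'

/-- Posterior inclusion probability `π(γ_j = 1 | y, ω) = Σ_{γ ∋ j} π(γ | y, ω)`. -/
def pip (X : Fin n → ι → ℝ) (z : ι → Fin B) (models : Finset (Finset ι))
    (φ g : ℝ) (ω : Fin B → ℝ) (y : Fin n → ℝ) (j : ι) : ℝ :=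
  ∑ γ ∈ models.filter (fun γ => j ∈ γ), post X z models φ g ω y γ

/-- The Gaussian measure `N(mean, φ I_n)` on `Fin n → ℝ`. -/
def gaussPi (n : ℕ) (mean : Fin n → ℝ) (φ : ℝ) : Measure (Fin n → ℝ) :=
  Measure.pi fun i => gaussianReal (mean i) φ.toNNReal

/-- The vector `X_s θ_s`, i.e. the combination of the columns of `X` in `s`
with coefficients `θ`. -/
def colComb (X : Fin n → ι → ℝ) (θ : ι → ℝ) (s : Finset ι) : Fin n → ℝ :=
  fun i => ∑ j ∈ s, X i j * θ j

/-- Smallest eigenvalue of a symmetric real matrix, as the infimum of the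
Rayleigh quotient. -/
def eigMin {m : Type*} [Fintype m] (M : Matrix m m ℝ) : ℝ :=
  ⨅ x : {v : m → ℝ // v ≠ 0}, (x.1 ⬝ᵥ (M *ᵥ x.1)) / (x.1 ⬝ᵥ x.1)

/-- Largest eigenvalue of a symmetric real matrix, as the supremum of the
Rayleigh quotient. -/
def eigMax {m : Type*} [Fintype m] (M : Matrix m m ℝ) : ℝ :=
  ⨆ x : {v : m → ℝ // v ≠ 0}, (x.1 ⬝ᵥ (M *ᵥ x.1)) / (x.1 ⬝ᵥ x.1)

/-- Noncentrality parameter `μ(γ, γ̃) = φ⁻¹ ‖(I − P_γ̃) X_{γ∖γ̃} θ_{γ∖γ̃}‖²`. -/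
def muNC (X : Fin n → ι → ℝ) (θ : ι → ℝ) (φ : ℝ) (γ γt : Finset ι) : ℝ :=
  φ⁻¹ * ∑ i, (((1 - projMat X γt) *ᵥ colComb X θ (γ \ γt)) i) ^ 2

/-- `ρ(X)`: minimum over considered models `γ` with `γ ⊉ γ*` of the smallest
eigenvalue of `(1/n) X_{γ*∖γ}ᵀ (I − P_γ) X_{γ*∖γ}`. -/
def rhoX (X : Fin n → ι → ℝ) (models : Finset (Finset ι)) (γstar : Finset ι) : ℝ :=
  sInf ((fun γ => eigMin ((n : ℝ)⁻¹ •
      ((subcols X (γstar \ γ))ᵀ * (1 - projMat X γ) * subcols X (γstar \ γ)))) ''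
    {γ | γ ∈ models ∧ ¬ γstar ⊆ γ})

/-- Block penalty `κ_b = (1/2) log(1 + g n) + log(1/ω_b − 1)`. -/
def kappa (g : ℝ) (n : ℕ) (ω : Fin B → ℝ) (b : Fin B) : ℝ :=
  Real.log (1 + g * n) / 2 + Real.log (1 / ω b - 1)

/-- Penalty difference `Δ(γ, γ̃) = Σ_b (p_{γ,b} − p_{γ̃,b}) κ_b`. -/
def Delta (z : ι → Fin B) (κ : Fin B → ℝ) (γ γt : Finset ι) : ℝ :=
  ∑ b : Fin B, ((blockCount z γ b : ℝ) - (blockCount z γt b : ℝ)) * κ b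

end Paper

open Paper

namespace Paper

section Projection

variable {n : ℕ} {ι : Type*}

theorem gram_transpose (X : Fin n → ι → ℝ) (γ : Finset ι) : (gram X γ)ᵀ = gram X γ := by
  simp [gram, transpose_mul]

variable [DecidableEq ι]

theorem projMat_transpose (X : Fin n → ι → ℝ) (γ : Finset ι) :
    (projMat X γ)ᵀ = projMat X γ := by
  simp [projMat, transpose_mul, transpose_nonsing_inv, gram_transpose, Matrix.mul_assoc]

theorem gram_inv_mul_gram_mul_gram_inv (X : Fin n → ι → ℝ) (γ : Finset ι) :
    (gram X γ)⁻¹ * gram X γ * (gram X γ)⁻¹ = (gram X γ)⁻¹ := by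
  by_cases h : IsUnit (gram X γ).det
  · rw [nonsing_inv_mul _ h, Matrix.one_mul]
  · simp [nonsing_inv_apply_not_isUnit _ h]

theorem projMat_mul_self (X : Fin n → ι → ℝ) (γ : Finset ι) :
    projMat X γ * projMat X γ = projMat X γ := by
  calc projMat X γ * projMat X γ
      = subcols X γ * ((gram X γ)⁻¹ * gram X γ * (gram X γ)⁻¹) * (subcols X γ)ᵀ := by
        simp only [projMat, gram, Matrix.mul_assoc]
    _ = projMat X γ := by rw [gram_inv_mul_gram_mul_gram_inv, projMat]

/-- The quadratic form `vᵀ Aᵀ (I − P_γ) A v` equals `‖(I − P_γ) A v‖²`. -/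
theorem dotProduct_residual_mulVec {m : Type*} [Fintype m] (X : Fin n → ι → ℝ) (γ : Finset ι)
    (A : Matrix (Fin n) m ℝ) (v : m → ℝ) :
    v ⬝ᵥ ((Aᵀ * (1 - projMat X γ) * A) *ᵥ v)
      = ∑ i, (((1 - projMat X γ) *ᵥ (A *ᵥ v)) i) ^ 2 := by
  have hQ : 1 - projMat X γ = (1 - projMat X γ)ᵀ * (1 - projMat X γ) := by
    rw [transpose_sub, transpose_one, projMat_transpose, Matrix.sub_mul, Matrix.mul_sub,
      Matrix.mul_sub, projMat_mul_self]
    simp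
  have hA : Aᵀ * (1 - projMat X γ) * A
      = ((1 - projMat X γ) * A)ᵀ * ((1 - projMat X γ) * A) := by
    conv_lhs => rw [hQ]
    simp only [transpose_mul, Matrix.mul_assoc]
  rw [hA, ← mulVec_mulVec, dotProduct_mulVec, vecMul_transpose, ← mulVec_mulVec]
  simp [dotProduct, pow_two]

theorem rayleigh_residual_nonneg {m : Type*} [Fintype m] (X : Fin n → ι → ℝ) (γ : Finset ι)
    (A : Matrix (Fin n) m ℝ) (v : m → ℝ) :
    0 ≤ (v ⬝ᵥ (((n : ℝ)⁻¹ • (Aᵀ * (1 - projMat X γ) * A)) *ᵥ v)) / (v ⬝ᵥ v) := by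
  rw [smul_mulVec, dotProduct_smul, dotProduct_residual_mulVec, smul_eq_mul]
  have h : 0 ≤ v ⬝ᵥ v := Finset.sum_nonneg fun i _ => mul_self_nonneg (v i)
  positivity

theorem rhoX_nonneg (X : Fin n → ι → ℝ) (models : Finset (Finset ι)) (γstar : Finset ι) :
    0 ≤ rhoX X models γstar := by
  refine Real.sInf_nonneg ?_
  rintro _ ⟨γ, -, rfl⟩
  exact Real.iInf_nonneg fun v => rayleigh_residual_nonneg X γ _ v.1

/-- `ρ(X)` bounds from below the quadratic form of `X_{γ*∖γ}ᵀ (I − P_γ) X_{γ*∖γ}`. -/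
theorem card_mul_rhoX_mul_le (X : Fin n → ι → ℝ) {models : Finset (Finset ι)}
    {γstar γ : Finset ι} (hγ : γ ∈ models) (hns : ¬ γstar ⊆ γ)
    (v : {j // j ∈ γstar \ γ} → ℝ) :
    n * rhoX X models γstar * (v ⬝ᵥ v)
      ≤ ∑ i, (((1 - projMat X γ) *ᵥ (subcols X (γstar \ γ) *ᵥ v)) i) ^ 2 := by
  by_cases hv : v = 0
  · simp [hv]
  have hpos : 0 < v ⬝ᵥ v :=
    lt_of_le_of_ne (Finset.sum_nonneg fun i _ => mul_self_nonneg (v i))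
      fun h => hv (dotProduct_self_eq_zero.mp h.symm)
  rcases Nat.eq_zero_or_pos n with hn | hn
  · subst hn
    simp
  have hn' : (0 : ℝ) < n := by exact_mod_cast hn
  have h1 : rhoX X models γstar ≤ eigMin ((n : ℝ)⁻¹ •
      ((subcols X (γstar \ γ))ᵀ * (1 - projMat X γ) * subcols X (γstar \ γ))) := by
    refine csInf_le ⟨0, ?_⟩ ⟨γ, ⟨hγ, hns⟩, rfl⟩
    rintro _ ⟨γ', -, rfl⟩
    exact Real.iInf_nonneg fun v => rayleigh_residual_nonneg X γ' _ v.1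
  have h2 := h1.trans (ciInf_le ⟨0, by
    rintro _ ⟨w, rfl⟩
    exact rayleigh_residual_nonneg X γ _ w.1⟩ ⟨v, hv⟩)
  rw [smul_mulVec, dotProduct_smul, dotProduct_residual_mulVec, smul_eq_mul,
    le_div_iff₀ hpos, inv_mul_eq_div, le_div_iff₀ hn'] at h2
  linarith

end Projection

theorem card_mul_sInf_sq_le_sum {ι : Type*} (s : Finset ι) (θ : ι → ℝ) :
    (s.card : ℝ) * sInf {r : ℝ | ∃ j ∈ s, r = θ j ^ 2} ≤ ∑ j ∈ s, θ j ^ 2 := by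
  rw [← nsmul_eq_mul]
  refine Finset.card_nsmul_le_sum s _ _ fun j hj => csInf_le ⟨0, ?_⟩ ⟨j, hj, rfl⟩
  rintro _ ⟨i, -, rfl⟩
  exact sq_nonneg _

theorem sum_block_card_mul_sInf_sq_le {ι : Type*} {B : ℕ} (z : ι → Fin B) (s : Finset ι)
    (θ : ι → ℝ) :
    ∑ b : Fin B, (((s.filter fun j => z j = b).card : ℝ) *
        sInf {r : ℝ | ∃ j ∈ s.filter (fun j => z j = b), r = θ j ^ 2})
      ≤ ∑ j ∈ s, θ j ^ 2 := by
  rw [← Finset.sum_fiberwise s z]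
  exact Finset.sum_le_sum fun b _ => card_mul_sInf_sq_le_sum _ θ

theorem sum_restrict_eq {ι : Type*} [DecidableEq ι] {s t : Finset ι} (h : t ⊆ s) (f : ι → ℝ) :
    ∑ j : {j // j ∈ s}, (if j.1 ∈ t then f j.1 else 0) = ∑ j ∈ t, f j := by
  rw [Finset.sum_coe_sort s fun j => if j ∈ t then f j else 0, Finset.sum_ite_mem,
    Finset.inter_eq_right.mpr h]

end Paper

/-- **Lower bound on the noncentrality parameter (Lemma on `ρ(X)`).**
In the Gaussian linear model with Zellner prior, for considered models
`γ̃ ⊆ γ*` with `γ̃ ⊄ γ`, the noncentrality parameter satisfies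
`μ(Γ(γ,γ̃), γ) ≥ n φ⁻¹ ρ(X) Σ_b |γ̃_b ∖ γ_b| min_{i ∈ γ̃_b∖γ_b} (θ*_i)²`,
where `Γ(γ,γ̃) = γ ∪ γ̃`. -/
theorem stmt_8
    (n p B : ℕ) (X : Fin n → Fin p → ℝ) (θ : Fin p → ℝ)
    (φ : ℝ) (hφ : 0 < φ)
    (z : Fin p → Fin B)
    (models : Finset (Finset (Fin p)))
    (γstar : Finset (Fin p)) (hγstar : ∀ j, j ∈ γstar ↔ θ j ≠ 0)
    (hrank : ∀ δ ∈ models, (subcols X δ).rank = δ.card)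
    (hstar : γstar ∈ models)
    (γ γt : Finset (Fin p)) (hγ : γ ∈ models)
    (hsub : γt ⊆ γstar) (hnsub : ¬ γt ⊆ γ) :
    (n : ℝ) * φ⁻¹ * rhoX X models γstar *
        ∑ b : Fin B, ((((γt \ γ).filter fun j => z j = b).card : ℝ) *
          sInf {r : ℝ | ∃ j ∈ (γt \ γ).filter (fun j => z j = b), r = θ j ^ 2})
      ≤ muNC X θ φ (γ ∪ γt) γ := by
  set s := γt \ γ with hs
  have hst : s ⊆ γstar \ γ := Finset.sdiff_subset_sdiff hsub subset_rfl
  have key := card_mul_rhoX_mul_le X hγ (fun h => hnsub (hsub.trans h))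
    (fun j : {j // j ∈ γstar \ γ} => if j.1 ∈ s then θ j.1 else 0)
  have hv : subcols X (γstar \ γ) *ᵥ (fun j => if j.1 ∈ s then θ j.1 else 0)
      = colComb X θ s := by
    ext i
    simp only [mulVec, dotProduct, subcols, colComb, mul_ite, mul_zero]
    exact sum_restrict_eq hst fun j => X i j * θ j
  have hvv : (fun j : {j // j ∈ γstar \ γ} => if j.1 ∈ s then θ j.1 else 0) ⬝ᵥ
      (fun j => if j.1 ∈ s then θ j.1 else 0) = ∑ j ∈ s, θ j ^ 2 := by
    rw [← sum_restrict_eq hst]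
    refine Finset.sum_congr rfl fun j _ => ?_
    by_cases h : j.1 ∈ s <;> simp [h, pow_two]
  rw [hv, hvv] at key
  have hρ := rhoX_nonneg X models γstar
  rw [muNC, Finset.union_sdiff_left, ← hs]
  calc _ ≤ (n : ℝ) * φ⁻¹ * rhoX X models γstar * ∑ j ∈ s, θ j ^ 2 :=
        mul_le_mul_of_nonneg_left (sum_block_card_mul_sInf_sq_le z s θ) (by positivity)
    _ = φ⁻¹ * (n * rhoX X models γstar * ∑ j ∈ s, θ j ^ 2) := by ring
    _ ≤ _ := mul_le_mul_of_nonneg_left key (by positivity)
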